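/- Let G be a Garside group of finite type, x ∈ G and v ∈ SC(x). Let s ≠ 1 be a positive element such that v^s ∈ SSS(x). If the iterated transport s^{(k)} at v equals 1 for some k ≥ 1, then s ∧ 𝔭(v) ≠ 1. -/

import Mathlib

/-- A Garside structure of finite type on a group `G`: a submonoid `P` of positive
elements with `P ∩ P⁻¹ = {1}`, such that the prefix order `a ⪯ b ↔ a⁻¹ * b ∈ P` is a
lattice order (with meet `wedge` and join `vee`), together with a Garside element `Δ ∈ P`
whose set of prefixes (the simple elements) is finite and generates `G`, satisfying
`Δ⁻¹ P Δ = P`, and such that every nontrivial positive element has a finite norm. -/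
structure GarsideStructure (G : Type*) [Group G] where
  P : Set G
  one_mem : (1 : G) ∈ P
  mul_mem : ∀ {a b : G}, a ∈ P → b ∈ P → a * b ∈ P
  eq_one_of_mem_of_inv_mem : ∀ a : G, a ∈ P → a⁻¹ ∈ P → a = 1
  wedge : G → G → G
  vee : G → G → G
  wedge_le_left : ∀ a b : G, (wedge a b)⁻¹ * a ∈ P
  wedge_le_right : ∀ a b : G, (wedge a b)⁻¹ * b ∈ P
  le_wedge : ∀ a b c : G, c⁻¹ * a ∈ P → c⁻¹ * b ∈ P → c⁻¹ * wedge a b ∈ P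
  le_vee_left : ∀ a b : G, a⁻¹ * vee a b ∈ P
  le_vee_right : ∀ a b : G, b⁻¹ * vee a b ∈ P
  vee_le : ∀ a b c : G, a⁻¹ * c ∈ P → b⁻¹ * c ∈ P → (vee a b)⁻¹ * c ∈ P
  Δ : G
  Δ_mem : Δ ∈ P
  simples_finite : {s : G | s ∈ P ∧ s⁻¹ * Δ ∈ P}.Finite
  simples_generate : Subgroup.closure {s : G | s ∈ P ∧ s⁻¹ * Δ ∈ P} = (⊤ : Subgroup G)
  conj_Delta_mem : ∀ a : G, a ∈ P → Δ⁻¹ * a * Δ ∈ P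
  mem_of_conj_Delta_mem : ∀ a : G, Δ⁻¹ * a * Δ ∈ P → a ∈ P
  norm_bounded : ∀ x : G, x ∈ P → x ≠ 1 →
    ∃ n : ℕ, ∀ L : List G, (∀ a ∈ L, a ∈ P ∧ a ≠ 1) → L.prod = x → L.length ≤ n

namespace GarsideStructure

variable {G : Type*} [Group G] (gs : GarsideStructure G)

/-- The prefix order: `a ⪯ b`. -/
def pre (a b : G) : Prop := a⁻¹ * b ∈ gs.P

/-- The suffix order: `a ≽ b` (i.e. `b` is a suffix of `a`). -/
def rdvd (a b : G) : Prop := a * b⁻¹ ∈ gs.P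

/-- Greatest common divisor with respect to the suffix order `≽` : `a ∧↰ b`. -/
def rwedge (a b : G) : G := (gs.vee a⁻¹ b⁻¹)⁻¹

/-- Least common multiple with respect to the suffix order `≽` : `a ∨↰ b`. -/
def rvee (a b : G) : G := (gs.wedge a⁻¹ b⁻¹)⁻¹

/-- Simple elements: positive prefixes of `Δ`. -/
def simple (s : G) : Prop := s ∈ gs.P ∧ s⁻¹ * gs.Δ ∈ gs.P

/-- Atoms: nontrivial positive elements which cannot be decomposed in `P`. -/
def atom (a : G) : Prop := a ∈ gs.P ∧ a ≠ 1 ∧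
  ∀ b c : G, b ∈ gs.P → c ∈ gs.P → a = b * c → b = 1 ∨ c = 1

/-- `inf x` : the maximal integer `p` with `Δ^p ⪯ x`. -/
noncomputable def ginf (x : G) : ℤ := sSup {p : ℤ | gs.pre (gs.Δ ^ p) x}

/-- `sup x` : the minimal integer `p` with `x ⪯ Δ^p`. -/
noncomputable def gsup (x : G) : ℤ := sInf {p : ℤ | gs.pre x (gs.Δ ^ p)}

/-- Canonical length `ℓ(x) = sup(x) - inf(x)`. -/
noncomputable def glen (x : G) : ℤ := gs.gsup x - gs.ginf x

/-- `‖x‖` : the maximal number of factors in a decomposition of `x` as a product of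
nontrivial positive elements. -/
noncomputable def gnorm (x : G) : ℕ :=
  sSup {k : ℕ | ∃ L : List G, (∀ a ∈ L, a ∈ gs.P ∧ a ≠ 1) ∧ L.prod = x ∧ L.length = k}

/-- The summit infimum `inf_s(x)` : the maximum of `inf` over the conjugacy class of `x`. -/
noncomputable def ginfs (x : G) : ℤ :=
  sSup {p : ℤ | ∃ y : G, (∃ α : G, α⁻¹ * x * α = y) ∧ p = gs.ginf y}

/-- The summit supremum `sup_s(x)` : the minimum of `sup` over the conjugacy class of `x`. -/
noncomputable def gsups (x : G) : ℤ :=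
  sInf {p : ℤ | ∃ y : G, (∃ α : G, α⁻¹ * x * α = y) ∧ p = gs.gsup y}

/-- The preferred prefix `𝔭(x) = (xΔ^{-inf x}) ∧ (x⁻¹Δ^{sup x}) ∧ Δ`. -/
noncomputable def pp (x : G) : G :=
  gs.wedge (gs.wedge (x * gs.Δ ^ (-gs.ginf x)) (x⁻¹ * gs.Δ ^ gs.gsup x)) gs.Δ

/-- Cyclic (left) sliding `𝔰(x) = 𝔭(x)⁻¹ x 𝔭(x)`. -/
noncomputable def sl (x : G) : G := (gs.pp x)⁻¹ * x * gs.pp x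

/-- The preferred suffix `𝔭↰(x) = (Δ^{-inf x}x) ∧↰ (Δ^{sup x}x⁻¹) ∧↰ Δ`. -/
noncomputable def ps (x : G) : G :=
  gs.rwedge (gs.rwedge (gs.Δ ^ (-gs.ginf x) * x) (gs.Δ ^ gs.gsup x * x⁻¹)) gs.Δ

/-- Cyclic right sliding `𝔰↰(x) = 𝔭↰(x) x 𝔭↰(x)⁻¹`. -/
noncomputable def rsl (x : G) : G := gs.ps x * x * (gs.ps x)⁻¹

/-- The super summit set `SSS(x)` : conjugates of `x` with maximal infimum and minimal
supremum among all conjugates of `x`. -/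
def SSS (x : G) : Set G :=
  {y | (∃ α : G, α⁻¹ * x * α = y) ∧
    ∀ z : G, (∃ α : G, α⁻¹ * x * α = z) → gs.ginf z ≤ gs.ginf y ∧ gs.gsup y ≤ gs.gsup z}

/-- The set of sliding circuits `SC(x)` : conjugates `y` of `x` with `𝔰^m(y) = y` for
some `m ≥ 1`. -/
noncomputable def SC (x : G) : Set G :=
  {y | (∃ α : G, α⁻¹ * x * α = y) ∧ ∃ m : ℕ, 1 ≤ m ∧ (gs.sl)^[m] y = y}

/-- The transport `α^{(1)} = 𝔭(x)⁻¹ α 𝔭(x^α)` of `α` at `x`. -/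
noncomputable def transport (x α : G) : G := (gs.pp x)⁻¹ * α * gs.pp (α⁻¹ * x * α)

/-- Iterated transport `α^{(i)}` of `α` at `x`: `α^{(0)} = α` and `α^{(i+1)}` is the
transport of `α^{(i)}` at `𝔰^i(x)`. -/
noncomputable def transportIter (x α : G) : ℕ → G
  | 0 => α
  | i + 1 => gs.transport ((gs.sl)^[i] x) (transportIter x α i)

/-- `c` is the `⪯`-minimal element `c_s(y)` satisfying `s ⪯ c` and `y^c ∈ SC(x)`. -/
def IsMinSCConj (x y s c : G) : Prop :=
  gs.pre s c ∧ (c⁻¹ * y * c) ∈ gs.SC x ∧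
    ∀ d : G, gs.pre s d → (d⁻¹ * y * d) ∈ gs.SC x → gs.pre c d

/-- `s` is an indecomposable conjugator starting at `u`: `u^s ∈ SC(x)`, `s ≠ 1` and there
is no `t` with `1 ≺ t ≺ s` and `u^t ∈ SC(x)`. -/
def IsIndecomposableConjugator (x u s : G) : Prop :=
  (s⁻¹ * u * s) ∈ gs.SC x ∧ s ≠ 1 ∧
    ¬ ∃ t : G, (gs.pre 1 t ∧ t ≠ 1) ∧ (gs.pre t s ∧ t ≠ s) ∧ (t⁻¹ * u * t) ∈ gs.SC x

/-- `u` is the pullback of `s` at `y = 𝔰(z)` : the `⪯`-minimal positive element with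
`z^u ∈ SSS(x)` and `s ⪯ u^{(1)}` (transport at `z`). -/
def IsPullback (x z s u : G) : Prop :=
  u ∈ gs.P ∧ (u⁻¹ * z * u) ∈ gs.SSS x ∧ gs.pre s (gs.transport z u) ∧
    ∀ u' : G, u' ∈ gs.P → (u'⁻¹ * z * u') ∈ gs.SSS x → gs.pre s (gs.transport z u') →
      gs.pre u u'

/-- The pullback `s_{(1)}` of `s` at `y = 𝔰(z)`. -/
noncomputable def pullbackOne (x z s : G) : G :=
  @Classical.epsilon G ⟨1⟩ (fun u => gs.IsPullback x z s u)

/-- The `k`-fold pullback `s_{(k)}` of `s` at `y = 𝔰^k(z)` (an element at `z`):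
`s_{(0)} = s` and `s_{(k+1)}` is the pullback at `𝔰(z)` (relative to `z`) of the `k`-fold
pullback of `s` at `𝔰^k(𝔰(z)) = y`. -/
noncomputable def pullbackIter (x : G) : G → ℕ → G → G
  | _, 0, s => s
  | z, k + 1, s => gs.pullbackOne x z (pullbackIter x (gs.sl z) k s)

end GarsideStructure

open GarsideStructure

variable {G : Type*} [Group G]

namespace GarsideStructure

theorem pre_refl (gs : GarsideStructure G) (a : G) : gs.pre a a := by
  simpa [pre] using gs.one_mem

theorem pre_trans (gs : GarsideStructure G) {a b c : G} (hab : gs.pre a b) (hbc : gs.pre b c) :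
    gs.pre a c := by
  have h := gs.mul_mem hab hbc
  rwa [show a⁻¹ * b * (b⁻¹ * c) = a⁻¹ * c by group] at h

theorem pre_antisymm (gs : GarsideStructure G) {a b : G} (hab : gs.pre a b) (hba : gs.pre b a) :
    a = b := by
  have h := gs.eq_one_of_mem_of_inv_mem (a⁻¹ * b) hab
    (by rw [show (a⁻¹ * b)⁻¹ = b⁻¹ * a by group]; exact hba)
  exact inv_mul_eq_one.mp h

theorem pre_mul_left (gs : GarsideStructure G) (a b c : G) :
    gs.pre a (b * c) ↔ gs.pre (b⁻¹ * a) c := by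
  simp only [pre, show (b⁻¹ * a)⁻¹ * c = a⁻¹ * (b * c) by group]

theorem pre_wedge_iff (gs : GarsideStructure G) (a b c : G) :
    gs.pre c (gs.wedge a b) ↔ gs.pre c a ∧ gs.pre c b :=
  ⟨fun h => ⟨gs.pre_trans h (gs.wedge_le_left a b), gs.pre_trans h (gs.wedge_le_right a b)⟩,
    fun h => gs.le_wedge a b c h.1 h.2⟩

theorem wedge_eq_one_iff (gs : GarsideStructure G) (a b : G) :
    gs.wedge a b = 1 ↔ ∀ c, (gs.pre c a ∧ gs.pre c b) ↔ gs.pre c 1 := by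
  constructor
  · intro h c
    rw [← gs.pre_wedge_iff, h]
  · intro h
    exact gs.pre_antisymm ((h _).1 ((gs.pre_wedge_iff _ _ _).1 (gs.pre_refl _)))
      ((gs.pre_wedge_iff _ _ _).2 ((h 1).2 (gs.pre_refl 1)))

theorem conj_zpow_mem_iff (gs : GarsideStructure G) (n : ℤ) (a : G) :
    gs.Δ ^ (-n) * a * gs.Δ ^ n ∈ gs.P ↔ a ∈ gs.P := by
  have hnat : ∀ (k : ℕ) (b : G), gs.Δ ^ (-(k : ℤ)) * b * gs.Δ ^ (k : ℤ) ∈ gs.P ↔ b ∈ gs.P := by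
    intro k
    induction k with
    | zero => simp
    | succ k ih =>
      intro b
      have h : gs.Δ ^ (-((k + 1 : ℕ) : ℤ)) * b * gs.Δ ^ ((k + 1 : ℕ) : ℤ)
          = gs.Δ⁻¹ * (gs.Δ ^ (-(k : ℤ)) * b * gs.Δ ^ (k : ℤ)) * gs.Δ := by
        push_cast
        group
      rw [h, ← ih b]
      exact ⟨gs.mem_of_conj_Delta_mem _, gs.conj_Delta_mem _⟩
  obtain ⟨k, rfl | rfl⟩ := n.eq_nat_or_neg
  · exact hnat k a
  · rw [← hnat k]
    congr! 1
    group

theorem pre_mul_zpow (gs : GarsideStructure G) (a b : G) (n : ℤ) :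
    gs.pre a (b * gs.Δ ^ n) ↔ gs.pre (a * gs.Δ ^ (-n)) b := by
  simp only [pre]
  rw [← gs.conj_zpow_mem_iff (-n)]
  congr! 1
  group

theorem exists_zpow_pre (gs : GarsideStructure G) (y : G) : ∃ p : ℤ, gs.pre (gs.Δ ^ p) y := by
  have hy : y ∈ Subgroup.closure {s : G | s ∈ gs.P ∧ s⁻¹ * gs.Δ ∈ gs.P} := by
    rw [gs.simples_generate]; trivial
  induction hy using Subgroup.closure_induction'' with
  | mem s hs => exact ⟨0, by simpa [pre] using hs.1⟩
  | inv_mem s hs =>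
    refine ⟨-1, ?_⟩
    rw [pre, ← gs.conj_zpow_mem_iff 1]
    convert hs.2 using 1
    group
  | one => exact ⟨0, by simpa using gs.pre_refl 1⟩
  | mul a b _ _ ha hb =>
    obtain ⟨p, hp⟩ := ha
    obtain ⟨q, hq⟩ := hb
    refine ⟨p + q, ?_⟩
    have h := gs.mul_mem ((gs.conj_zpow_mem_iff q _).2 hp) hq
    rw [pre]
    convert h using 1
    group

theorem exists_pre_zpow (gs : GarsideStructure G) (y : G) : ∃ q : ℤ, gs.pre y (gs.Δ ^ q) := by
  obtain ⟨p, hp⟩ := gs.exists_zpow_pre y⁻¹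
  refine ⟨-p, ?_⟩
  have h := (gs.conj_zpow_mem_iff (-p) _).2 hp
  rw [pre]
  convert h using 1
  group

theorem zpow_mem (gs : GarsideStructure G) {n : ℤ} (hn : 0 ≤ n) : gs.Δ ^ n ∈ gs.P := by
  lift n to ℕ using hn
  induction n with
  | zero => simpa using gs.one_mem
  | succ k ih =>
    have h := gs.mul_mem ih gs.Δ_mem
    rwa [← zpow_add_one] at h

theorem Δ_ne_one (gs : GarsideStructure G) {s : G} (hs : s ≠ 1) : gs.Δ ≠ 1 := by
  intro h
  have hsub : {s : G | s ∈ gs.P ∧ s⁻¹ * gs.Δ ∈ gs.P} ⊆ {1} := by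
    rintro t ⟨ht, ht'⟩
    rw [h, mul_one] at ht'
    exact gs.eq_one_of_mem_of_inv_mem t ht ht'
  have hmem : s ∈ Subgroup.closure {s : G | s ∈ gs.P ∧ s⁻¹ * gs.Δ ∈ gs.P} := by
    rw [gs.simples_generate]; trivial
  have h1 := Subgroup.closure_mono hsub hmem
  rw [Subgroup.closure_singleton_one] at h1
  exact hs h1

theorem le_of_zpow_pre_zpow (gs : GarsideStructure G) (hΔ : gs.Δ ≠ 1) {p q : ℤ}
    (h : gs.pre (gs.Δ ^ p) (gs.Δ ^ q)) : p ≤ q := by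
  by_contra! hlt
  refine hΔ (gs.eq_one_of_mem_of_inv_mem _ gs.Δ_mem ?_)
  have h' := gs.mul_mem h (gs.zpow_mem (show 0 ≤ p - q - 1 by omega))
  convert h' using 1
  group

theorem bddAbove_zpow_pre (gs : GarsideStructure G) (hΔ : gs.Δ ≠ 1) (y : G) :
    BddAbove {p : ℤ | gs.pre (gs.Δ ^ p) y} := by
  obtain ⟨q, hq⟩ := gs.exists_pre_zpow y
  exact ⟨q, fun p hp => gs.le_of_zpow_pre_zpow hΔ (gs.pre_trans hp hq)⟩

theorem bddBelow_pre_zpow (gs : GarsideStructure G) (hΔ : gs.Δ ≠ 1) (y : G) :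
    BddBelow {q : ℤ | gs.pre y (gs.Δ ^ q)} := by
  obtain ⟨p, hp⟩ := gs.exists_zpow_pre y
  exact ⟨p, fun q hq => gs.le_of_zpow_pre_zpow hΔ (gs.pre_trans hp hq)⟩

theorem zpow_ginf_pre (gs : GarsideStructure G) (hΔ : gs.Δ ≠ 1) (y : G) :
    gs.pre (gs.Δ ^ gs.ginf y) y :=
  Int.csSup_mem (gs.exists_zpow_pre y) (gs.bddAbove_zpow_pre hΔ y)

theorem pre_zpow_gsup (gs : GarsideStructure G) (hΔ : gs.Δ ≠ 1) (y : G) :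
    gs.pre y (gs.Δ ^ gs.gsup y) :=
  Int.csInf_mem (gs.exists_pre_zpow y) (gs.bddBelow_pre_zpow hΔ y)

theorem pre_pp_iff (gs : GarsideStructure G) (y d : G) :
    gs.pre d (gs.pp y) ↔ gs.pre d (y * gs.Δ ^ (-gs.ginf y)) ∧
      gs.pre d (y⁻¹ * gs.Δ ^ gs.gsup y) ∧ gs.pre d gs.Δ := by
  rw [pp, pre_wedge_iff, pre_wedge_iff, and_assoc]

theorem pp_mem (gs : GarsideStructure G) (hΔ : gs.Δ ≠ 1) (y : G) : gs.pp y ∈ gs.P := by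
  have h : gs.pre 1 (gs.pp y) := by
    rw [pre_pp_iff]
    refine ⟨?_, ?_, ?_⟩
    · rw [pre_mul_zpow, one_mul, neg_neg]
      exact gs.zpow_ginf_pre hΔ y
    · rw [pre_mul_left, inv_inv, mul_one]
      exact gs.pre_zpow_gsup hΔ y
    · simpa [pre] using gs.Δ_mem
  simpa [pre] using h

theorem ginf_le_ginf_sl (gs : GarsideStructure G) (hΔ : gs.Δ ≠ 1) (y : G) :
    gs.ginf y ≤ gs.ginf (gs.sl y) := by
  refine le_csSup (gs.bddAbove_zpow_pre hΔ _) ?_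
  have h1 := ((gs.pre_pp_iff y _).1 (gs.pre_refl _)).1
  rw [pre, ← gs.conj_zpow_mem_iff (gs.ginf y)] at h1
  have h := gs.mul_mem h1 (gs.pp_mem hΔ y)
  rw [Set.mem_ofPred_eq, pre, sl]
  convert h using 1
  group

theorem gsup_sl_le_gsup (gs : GarsideStructure G) (hΔ : gs.Δ ≠ 1) (y : G) :
    gs.gsup (gs.sl y) ≤ gs.gsup y := by
  refine csInf_le (gs.bddBelow_pre_zpow hΔ _) ?_
  have h1 := ((gs.pre_pp_iff y _).1 (gs.pre_refl _)).2.1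
  have h := gs.mul_mem h1 ((gs.conj_zpow_mem_iff (gs.gsup y) _).2 (gs.pp_mem hΔ y))
  rw [Set.mem_ofPred_eq, pre, sl]
  convert h using 1
  group

theorem sl_mem_SSS (gs : GarsideStructure G) (hΔ : gs.Δ ≠ 1) {x y : G} (hy : y ∈ gs.SSS x) :
    gs.sl y ∈ gs.SSS x := by
  obtain ⟨⟨α, rfl⟩, hmax⟩ := hy
  refine ⟨⟨α * gs.pp (α⁻¹ * x * α), ?_⟩, fun z hz => ?_⟩
  · rw [sl]; group
  · exact ⟨(hmax z hz).1.trans (gs.ginf_le_ginf_sl hΔ _),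
      (gs.gsup_sl_le_gsup hΔ _).trans (hmax z hz).2⟩

theorem iterate_sl_mem_SSS (gs : GarsideStructure G) (hΔ : gs.Δ ≠ 1) {x y : G}
    (hy : y ∈ gs.SSS x) (n : ℕ) : (gs.sl)^[n] y ∈ gs.SSS x := by
  induction n with
  | zero => exact hy
  | succ n ih =>
    rw [Function.iterate_succ_apply']
    exact gs.sl_mem_SSS hΔ ih

theorem ginf_eq_of_mem_SSS (gs : GarsideStructure G) {x y z : G} (hy : y ∈ gs.SSS x)
    (hz : z ∈ gs.SSS x) : gs.ginf y = gs.ginf z :=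
  le_antisymm (hz.2 y hy.1).1 (hy.2 z hz.1).1

theorem gsup_eq_of_mem_SSS (gs : GarsideStructure G) {x y z : G} (hy : y ∈ gs.SSS x)
    (hz : z ∈ gs.SSS x) : gs.gsup y = gs.gsup z :=
  le_antisymm (hy.2 z hz.1).2 (hz.2 y hy.1).2

theorem pre_mul_pp_conj_iff (gs : GarsideStructure G) {x y s : G} (hy : y ∈ gs.SSS x)
    (hs : s⁻¹ * y * s ∈ gs.SSS x) (d : G) :
    gs.pre d (s * gs.pp (s⁻¹ * y * s)) ↔
      gs.pre (y⁻¹ * d * gs.Δ ^ gs.ginf y) s ∧ gs.pre (y * d * gs.Δ ^ (-gs.gsup y)) s ∧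
        gs.pre (d * gs.Δ ^ (-1 : ℤ)) s := by
  rw [pre_mul_left, pre_pp_iff, gs.ginf_eq_of_mem_SSS hs hy, gs.gsup_eq_of_mem_SSS hs hy,
    ← pre_mul_left, ← pre_mul_left, ← pre_mul_left]
  have e1 : s * (s⁻¹ * y * s * gs.Δ ^ (-gs.ginf y)) = y * (s * gs.Δ ^ (-gs.ginf y)) := by group
  have e2 : s * ((s⁻¹ * y * s)⁻¹ * gs.Δ ^ gs.gsup y) = y⁻¹ * (s * gs.Δ ^ gs.gsup y) := by group
  rw [e1, e2, pre_mul_left, pre_mul_left _ _ y⁻¹, inv_inv, pre_mul_zpow, pre_mul_zpow, neg_neg,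
    ← pre_mul_zpow _ _ s 1, zpow_one]

theorem wedge_transport_eq_one (gs : GarsideStructure G) {x y s t : G} (hy : y ∈ gs.SSS x)
    (hs : s⁻¹ * y * s ∈ gs.SSS x) (ht : t⁻¹ * y * t ∈ gs.SSS x) (hst : gs.wedge s t = 1) :
    gs.wedge (gs.transport y s) (gs.transport y t) = 1 := by
  rw [wedge_eq_one_iff] at hst ⊢
  intro c
  have h1 := gs.pre_mul_pp_conj_iff (s := 1) hy (by simpa using hy) (gs.pp y * c)
  have hs' := gs.pre_mul_pp_conj_iff hy hs (gs.pp y * c)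
  have ht' := gs.pre_mul_pp_conj_iff hy ht (gs.pp y * c)
  rw [show 1 * gs.pp (1⁻¹ * y * 1) = gs.pp y * 1 by simp, pre_mul_left,
    inv_mul_cancel_left] at h1
  rw [transport, transport, mul_assoc _ s, mul_assoc _ t, pre_mul_left,
    pre_mul_left _ _ (gs.pp y)⁻¹, inv_inv, h1, hs', ht', ← hst, ← hst, ← hst]
  tauto

theorem transport_pp (gs : GarsideStructure G) (y : G) :
    gs.transport y (gs.pp y) = gs.pp (gs.sl y) := by
  simp [transport, sl]

theorem conj_transport (gs : GarsideStructure G) (y s : G) :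
    (gs.transport y s)⁻¹ * gs.sl y * gs.transport y s = gs.sl (s⁻¹ * y * s) := by
  simp only [transport, sl]
  group

theorem conj_transportIter (gs : GarsideStructure G) (y s : G) (n : ℕ) :
    (gs.transportIter y s n)⁻¹ * (gs.sl)^[n] y * gs.transportIter y s n
      = (gs.sl)^[n] (s⁻¹ * y * s) := by
  induction n with
  | zero => rfl
  | succ n ih =>
    rw [Function.iterate_succ_apply', Function.iterate_succ_apply', transportIter,
      conj_transport, ih]

theorem wedge_transportIter_eq_one (gs : GarsideStructure G) (hΔ : gs.Δ ≠ 1) {x y s : G}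
    (hy : y ∈ gs.SSS x) (hs : s⁻¹ * y * s ∈ gs.SSS x) (h : gs.wedge s (gs.pp y) = 1) (n : ℕ) :
    gs.wedge (gs.transportIter y s n) (gs.pp ((gs.sl)^[n] y)) = 1 := by
  induction n with
  | zero => exact h
  | succ n ih =>
    rw [Function.iterate_succ_apply', transportIter, ← transport_pp]
    have hyn := gs.iterate_sl_mem_SSS hΔ hy n
    refine gs.wedge_transport_eq_one hyn ?_ (gs.sl_mem_SSS hΔ hyn) ih
    rw [conj_transportIter]
    exact gs.iterate_sl_mem_SSS hΔ hs n

theorem eq_one_of_transport_eq_one (gs : GarsideStructure G) (hΔ : gs.Δ ≠ 1) {y s : G}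
    (h : gs.wedge s (gs.pp y) = 1) (ht : gs.transport y s = 1) : s = 1 := by
  have hpp : gs.pp y = s * gs.pp (s⁻¹ * y * s) := by
    rw [transport, mul_assoc] at ht
    exact inv_mul_eq_one.mp ht
  have hle : gs.pre s (gs.pp y) := by
    rw [hpp, pre, inv_mul_cancel_left]
    exact gs.pp_mem hΔ _
  rw [wedge_eq_one_iff] at h
  exact gs.pre_antisymm ((h s).1 ⟨gs.pre_refl s, hle⟩) ((h 1).2 (gs.pre_refl 1)).1

theorem mem_SSS_of_transportIter_eq_one (gs : GarsideStructure G) (hΔ : gs.Δ ≠ 1) {x v s : G}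
    (hv : v ∈ gs.SC x) (hvs : s⁻¹ * v * s ∈ gs.SSS x) {k : ℕ}
    (htr : gs.transportIter v s k = 1) : v ∈ gs.SSS x := by
  obtain ⟨-, m, hm, hper⟩ := hv
  have hk : (gs.sl)^[k] v ∈ gs.SSS x := by
    have h := gs.iterate_sl_mem_SSS hΔ hvs k
    rw [← conj_transportIter, htr] at h
    simpa using h
  have h := gs.iterate_sl_mem_SSS hΔ hk (m * k - k)
  rwa [← Function.iterate_add_apply, Nat.sub_add_cancel (Nat.le_mul_of_pos_left k hm),
    Function.iterate_mul, Function.iterate_fixed hper] at h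

end GarsideStructure

/-- If some iterated transport of a nontrivial positive element `s` at `v ∈ SC(x)` is
trivial, then `s ∧ 𝔭(v) ≠ 1`. -/
theorem transport_trivial_wedge (gs : GarsideStructure G) (x v s : G)
    (hv : v ∈ gs.SC x) (hs : s ∈ gs.P) (hs1 : s ≠ 1)
    (hvs : s⁻¹ * v * s ∈ gs.SSS x)
    (k : ℕ) (hk : 1 ≤ k) (htr : gs.transportIter v s k = 1) :
    gs.wedge s (gs.pp v) ≠ 1 := by
  intro hw
  have hΔ := gs.Δ_ne_one hs1
  have hvS := gs.mem_SSS_of_transportIter_eq_one hΔ hv hvs htr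
  have hne : ∀ n, gs.transportIter v s n ≠ 1 := by
    intro n
    induction n with
    | zero => exact hs1
    | succ n ih =>
      exact fun h => ih (gs.eq_one_of_transport_eq_one hΔ
        (gs.wedge_transportIter_eq_one hΔ hvS hvs hw n) h)
  exact hne k htr
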